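/- Let I, J, K ⊆ S be finitary with |I| = |J| = |K|, let p be an (I,J)-coset and q a (J,K)-coset, and suppose the composition of p and q is reduced. If the (I,K)-coset W_I·p̄·w_J·q̄·W_K is core, then both p and q are core. -/

import Mathlib

namespace CoxeterAtoms

variable {B : Type*} {W : Type*} [Group W] {M : CoxeterMatrix B}

/-- The standard parabolic subgroup `W_K` generated by the simple reflections indexed by `K`. -/
def par (cs : CoxeterSystem M W) (K : Set B) : Subgroup W :=
  Subgroup.closure (cs.simple '' K)

/-- `K` is finitary if `W_K` is finite. -/
def Finitary (cs : CoxeterSystem M W) (K : Set B) : Prop :=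
  ((par cs K : Set W)).Finite

/-- The left coset `W_I · x`. -/
def lcos (cs : CoxeterSystem M W) (I : Set B) (x : W) : Set W :=
  {w | ∃ a ∈ par cs I, w = a * x}

/-- The right coset `x · W_J`. -/
def rcos (cs : CoxeterSystem M W) (x : W) (J : Set B) : Set W :=
  {w | ∃ b ∈ par cs J, w = x * b}

/-- The double coset `W_I · x · W_J`. -/
def dcos (cs : CoxeterSystem M W) (I : Set B) (x : W) (J : Set B) : Set W :=
  {w | ∃ a ∈ par cs I, ∃ b ∈ par cs J, w = a * x * b}

/-- `x` is a minimal length element of its double coset `W_I · x · W_J`. -/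
def IsMinRep (cs : CoxeterSystem M W) (I : Set B) (x : W) (J : Set B) : Prop :=
  ∀ w ∈ dcos cs I x J, cs.length x ≤ cs.length w

/-- `y` is a maximal length element of the set `p`. -/
def IsMaxOf (cs : CoxeterSystem M W) (p : Set W) (y : W) : Prop :=
  y ∈ p ∧ ∀ w ∈ p, cs.length w ≤ cs.length y

/-- `y` is the longest element of the standard parabolic subgroup `W_K`. -/
def IsLongest (cs : CoxeterSystem M W) (K : Set B) (y : W) : Prop :=
  y ∈ par cs K ∧ ∀ w ∈ par cs K, cs.length w ≤ cs.length y

/-- The double coset `W_I · x · W_J` is core: `W_I·x = W_I·x·W_J = x·W_J`. -/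
def IsCore (cs : CoxeterSystem M W) (I : Set B) (x : W) (J : Set B) : Prop :=
  lcos cs I x = dcos cs I x J ∧ dcos cs I x J = rcos cs x J

open Polynomial.Chebyshev in
theorem dihedral_refl {V : Type*} [AddCommGroup V] [Module ℝ V] {x y : V} {f g : Module.Dual ℝ V}
    (hf : f x = 2) (hg : g y = 2) (m : ℕ) (hm : m ≠ 1)
    (hfy : f y = -2 * Real.cos (Real.pi / m)) (hgx : g x = -2 * Real.cos (Real.pi / m)) :
    (Module.reflection hf * Module.reflection hg) ^ m = 1 := by
  ext z
  rcases Nat.lt_or_ge m 3 with h3 | h3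
  · obtain rfl | rfl : m = 0 ∨ m = 2 := by omega
    · simp
    · have h1 : f y = 0 := by rw [hfy]; simp
      have h2 : g x = 0 := by rw [hgx]; simp
      simp [pow_two, Module.reflection_apply, h1, h2, hf, hg]
      module
  rw [Module.reflection_mul_reflection_pow_apply hf hg m z (2 * Real.cos (2 * Real.pi / m))
    (by
      rw [hfy, hgx, mul_div_assoc, Real.cos_two_mul]; ring)]
  have hm0 : (0:ℝ) < m := by positivity
  have hs : Real.sin (2 * Real.pi / m) ≠ 0 := by
    apply ne_of_gt
    apply Real.sin_pos_of_pos_of_lt_pi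
    · positivity
    · rw [div_lt_iff₀ hm0]
      have : (3:ℝ) ≤ m := by exact_mod_cast h3
      nlinarith [Real.pi_pos]
  have key := fun n : ℤ => S_two_mul_real_cos (2 * Real.pi / m) n
  rcases Nat.even_or_odd' m with ⟨k, rfl | rfl⟩
  · have e1 : (((2 * k : ℕ) : ℤ) - 2) / 2 = (k : ℤ) - 1 := by push_cast; omega
    have e2 : (((2 * k : ℕ) : ℤ) - 1) / 2 = (k : ℤ) - 1 := by push_cast; omega
    have z0 : (S ℝ ((k : ℤ) - 1)).eval (2 * Real.cos (2 * Real.pi / (2 * k : ℕ))) = 0 := by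
      have := key ((k : ℤ) - 1)
      have e : (((k : ℤ) - 1 : ℤ) + 1 : ℝ) * (2 * Real.pi / (2 * k : ℕ)) = Real.pi := by
        have : (k : ℝ) ≠ 0 := by
          rintro h; simp [h] at hm0
        push_cast; field_simp; ring
      rw [e, Real.sin_pi] at this
      exact (mul_eq_zero.mp this).resolve_right hs
    rw [e1, e2, z0]; simp
  · have e1 : (((2 * k + 1 : ℕ) : ℤ) - 3) / 2 = (k : ℤ) - 1 := by push_cast; omega
    have e2 : (((2 * k + 1: ℕ) : ℤ) - 1) / 2 = (k : ℤ) := by push_cast; omega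
    have e3 : (((2 * k + 1: ℕ) : ℤ) - 2) / 2 = (k : ℤ) - 1 := by push_cast; omega
    have e4 : (((2 * k + 1: ℕ) : ℤ)) / 2 = (k : ℤ) := by push_cast; omega
    have z0 : (S ℝ (k : ℤ)).eval (2 * Real.cos (2 * Real.pi / (2 * k + 1 : ℕ))) +
      (S ℝ ((k : ℤ) - 1)).eval (2 * Real.cos (2 * Real.pi / (2 * k + 1 : ℕ))) = 0 := by
      have h1 := key ((k : ℤ) - 1)
      have h2 := key (k : ℤ)
      have e : (((k : ℤ) - 1 : ℤ) + 1 : ℝ) * (2 * Real.pi / (2 * k + 1: ℕ)) =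
         2 * Real.pi - ((k : ℤ) + 1 : ℝ) * (2 * Real.pi / (2 * k + 1: ℕ)) := by
        push_cast; field_simp; ring
      rw [e, Real.sin_two_pi_sub] at h1
      refine (mul_eq_zero.mp ?_).resolve_right hs
      rw [add_mul, h1, h2]; ring
    rw [e1, e2, e3, e4, z0]; simp

theorem simple_inj {B : Type*} {W : Type*} [Group W] {M : CoxeterMatrix B}
    (cs : CoxeterSystem M W) : Function.Injective cs.simple := by
  classical
  let f : B → Module.Dual ℝ (B →₀ ℝ) := fun i =>
    Finsupp.linearCombination ℝ (fun j => -2 * Real.cos (Real.pi / M i j))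
  have ff : ∀ i j, f i (Finsupp.single j 1) = -2 * Real.cos (Real.pi / M i j) := by
    intro i j; simp [f]
  have h2 : ∀ i, f i (Finsupp.single i 1) = 2 := by intro i; rw [ff]; simp
  let r : B → ((B →₀ ℝ) ≃ₗ[ℝ] (B →₀ ℝ)) := fun i => Module.reflection (h2 i)
  have hr : M.IsLiftable r := by
    intro i j
    by_cases hij : i = j
    · subst hij
      simp only [M.diagonal, pow_one]
      ext1 z
      exact Module.involutive_reflection (h2 i) z
    · refine dihedral_refl (h2 i) (h2 j) _ (M.off_diagonal i j hij) (ff i j) ?_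
      rw [ff, M.symmetric]
  intro i j hij
  by_contra hne
  have h := congrArg (cs.lift ⟨r, hr⟩) hij
  rw [cs.lift_apply_simple, cs.lift_apply_simple] at h
  have h' := congrArg (fun v => v i) (LinearEquiv.congr_fun h (Finsupp.single i 1))
  simp only [r, Module.reflection_apply] at h'
  rw [h2, Finsupp.sub_apply, Finsupp.sub_apply, Finsupp.smul_apply, Finsupp.smul_apply, Finsupp.single_eq_same, Finsupp.single_eq_of_ne (by tauto)] at h'
  norm_num at h'

theorem exch {B : Type*} {W : Type*} [Group W] {M : CoxeterMatrix B}
    (cs : CoxeterSystem M W) (ω : List B) (i : B)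
    (h : cs.length (cs.wordProd ω * cs.simple i) < cs.length (cs.wordProd ω)) :
    ∃ a, a < ω.length ∧ cs.wordProd ω * cs.simple i = cs.wordProd (ω.eraseIdx a) := by
  classical
  let δ : W → W → ZMod 2 := fun t u => if t = u then 1 else 0
  let F : B → (W × ZMod 2 → W × ZMod 2) := fun i p =>
    (cs.simple i * p.1 * cs.simple i, p.2 + δ p.1 (cs.simple i))
  let G : B → Function.End (W × ZMod 2) := F
  have hG : M.IsLiftable G := by
    intro i j
    set c := cs.simple i * cs.simple j with hc
    have hjc : cs.simple j * c * cs.simple j = c⁻¹ := by simp [hc, mul_assoc]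
    have hjc' : ∀ k : ℕ, c ^ k * cs.simple j * c ^ k = cs.simple j := by
      intro k
      induction k with
      | zero => simp
      | succ k ih =>
        rw [pow_succ' c k]
        nth_rw 2 [(Commute.refl c).pow_right k |>.eq]
        calc c * c ^ k * cs.simple j * (c ^ k * c)
            = c * (c ^ k * cs.simple j * c ^ k) * c := by group
          _ = cs.simple j := by rw [ih]; simp [hc, mul_assoc]
    let g : W → ℕ → ZMod 2 := fun t l => δ (c ^ l * t) (cs.simple j)
    have key : ∀ n : ℕ, ∀ p : W × ZMod 2, ((G i * G j) ^ n) p =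
        (c ^ n * p.1 * (c ^ n)⁻¹, p.2 + ∑ l ∈ Finset.range (2 * n), g p.1 l) := by
      intro n
      induction n with
      | zero => intro p; simp [Function.End.one_def]
      | succ n ih =>
        intro p
        rw [pow_succ']
        change G i (G j (((G i * G j) ^ n) p)) = _
        rw [ih]
        have e1 : ∀ u, F i (F j u) = (c * u.1 * c⁻¹,
            u.2 + δ u.1 (cs.simple j) + δ (cs.simple j * u.1 * cs.simple j) (cs.simple i)) := by
          intro u; simp [F, hc, mul_assoc]
        change F i (F j _) = _
        rw [e1]
        have e2 : 2 * (n + 1) = 2 * n + 1 + 1 := by ring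
        rw [e2, Finset.sum_range_succ, Finset.sum_range_succ]
        ext1
        · simp [pow_succ', mul_assoc]
        · have a1 : δ (c ^ n * p.1 * (c ^ n)⁻¹) (cs.simple j) = g p.1 (2 * n) := by
            simp only [g, δ]
            congr 1
            apply propext
            rw [mul_inv_eq_iff_eq_mul]
            nth_rw 2 [← hjc' n]
            rw [two_mul, pow_add, mul_assoc (c ^ n) (c ^ n), mul_assoc (c ^ n) (cs.simple j), mul_right_inj]
          have a2 : δ (cs.simple j * (c ^ n * p.1 * (c ^ n)⁻¹) * cs.simple j) (cs.simple i)
              = g p.1 (2 * n + 1) := by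
            simp only [g, δ]
            congr 1
            apply propext
            have b1 : cs.simple j * (c ^ n * p.1 * (c ^ n)⁻¹) * cs.simple j = cs.simple i ↔
               c ^ n * p.1 * (c ^ n)⁻¹ = c⁻¹ * cs.simple j := by
              constructor
              · intro h; 
                have := congrArg (fun z => cs.simple j * z * cs.simple j) h
                simpa [mul_assoc, hc] using this
              · intro h; rw [h]; simp [mul_assoc, hc]
            rw [b1, mul_inv_eq_iff_eq_mul, ← mul_right_inj c,
              ← mul_right_inj (c ^ n)]
            have b2 : c ^ n * (c * (c ⁻¹ * cs.simple j * c ^ n)) = cs.simple j := by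
              rw [← mul_assoc c, mul_inv_cancel_left, ← mul_assoc, hjc']
            rw [b2, two_mul, pow_succ, pow_add]
            have b3 : c ^ n * (c * (c ^ n * p.1)) = c ^ n * c ^ n * c * p.1 := by
              rw [mul_assoc (c ^ n) (c ^ n) c, ← (Commute.refl c).pow_right n |>.eq]; group
            rw [b3]
          rw [a1, a2]
          simp [add_assoc]
    have hcm : c ^ M i j = 1 := cs.simple_mul_simple_pow i j
    funext p
    rw [key]
    have e : ∑ l ∈ Finset.range (2 * M i j), g p.1 l = 0 := by
      rw [two_mul, Finset.sum_range_add]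
      have : ∀ l, g p.1 (M i j + l) = g p.1 l := by
        intro l; simp [g, pow_add, hcm]
      simp only [this]
      exact CharTwo.add_self_eq_zero _
    rw [e, hcm]; simp [Function.End.one_def]
  let φ := cs.lift ⟨G, hG⟩
  have hφ : ∀ (ω : List B) (p : W × ZMod 2), φ (cs.wordProd ω) p =
      (cs.wordProd ω * p.1 * (cs.wordProd ω)⁻¹, p.2 + ((cs.rightInvSeq ω).count p.1 : ZMod 2)) := by
    intro ω p
    induction ω with
    | nil => simp [Function.End.one_def]
    | cons k ω ih =>
      rw [cs.wordProd_cons, map_mul]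
      change φ (cs.simple k) (φ (cs.wordProd ω) p) = _
      rw [ih]
      have : φ (cs.simple k) = F k := cs.lift_apply_simple hG k
      rw [this]
      simp only [F, δ]
      ext1
      · simp [mul_assoc]
      · rw [CoxeterSystem.rightInvSeq, List.count_cons]
        have : (cs.wordProd ω * p.1 * (cs.wordProd ω)⁻¹ = cs.simple k) ↔
          ((cs.wordProd ω)⁻¹ * cs.simple k * cs.wordProd ω = p.1) := by
          constructor
          · intro h; rw [← h]; group
          · intro h; rw [← h]; group
        simp [this, add_assoc]
  obtain ⟨ω', hω', he⟩ := cs.exists_isReduced (cs.wordProd ω * cs.simple i)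
  have hp : cs.wordProd (ω'.concat i) = cs.wordProd ω := by
    rw [cs.wordProd_concat, ← he]; simp
  have hred : cs.IsReduced (ω'.concat i) := by
    have h1 := cs.length_wordProd_le (ω'.concat i)
    have h2 := hω'.eq
    rw [← he] at h2
    unfold CoxeterSystem.IsReduced
    rw [hp] at h1 ⊢
    simp at h1 ⊢
    omega
  have hnd := hred.nodup_rightInvSeq
  have hc1 : (cs.rightInvSeq (ω'.concat i)).count (cs.simple i) = 1 := by
    apply List.count_eq_one_of_mem hnd
    rw [cs.rightInvSeq_concat]; simp
  have q1 := hφ ω (cs.simple i, 0)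
  have q2 := hφ (ω'.concat i) (cs.simple i, 0)
  rw [hp, hc1, q1] at q2
  have q3 := congrArg Prod.snd q2
  simp only [zero_add] at q3
  have hmem : cs.simple i ∈ cs.rightInvSeq ω := by
    by_contra hn
    rw [List.count_eq_zero_of_not_mem hn] at q3
    simp at q3
  obtain ⟨a, ha, hea⟩ := List.mem_iff_getElem.mp hmem
  refine ⟨a, by simpa using ha, ?_⟩
  rw [← cs.wordProd_mul_getD_rightInvSeq, List.getD_eq_getElem _ _ ha, hea]

theorem word_mem (cs : CoxeterSystem M W) {J : Set B} {ω : List B} (h : ∀ j ∈ ω, j ∈ J) :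
    cs.wordProd ω ∈ par cs J := by
  induction ω with
  | nil => simpa using (par cs J).one_mem
  | cons k ω ih =>
    rw [cs.wordProd_cons]
    refine (par cs J).mul_mem (Subgroup.subset_closure ⟨k, h k (by simp), rfl⟩)
      (ih fun j hj => h j (by simp [hj]))

theorem par_word (cs : CoxeterSystem M W) {J : Set B} {b : W} (hb : b ∈ par cs J) :
    ∃ ω : List B, (∀ j ∈ ω, j ∈ J) ∧ cs.wordProd ω = b ∧ ω.length = cs.length b := by
  have step : ∀ (x : W) (j : B), j ∈ J →
      (∃ ω : List B, (∀ j ∈ ω, j ∈ J) ∧ cs.wordProd ω = x ∧ ω.length = cs.length x) →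
      ∃ ω : List B, (∀ j ∈ ω, j ∈ J) ∧ cs.wordProd ω = x * cs.simple j ∧
        ω.length = cs.length (x * cs.simple j) := by
    rintro x j hj ⟨ω, h1, rfl, h3⟩
    rcases cs.length_mul_simple (cs.wordProd ω) j with h | h
    · refine ⟨ω ++ [j], ?_, ?_, ?_⟩
      · intro k hk
        rcases List.mem_append.mp hk with hk | hk
        · exact h1 k hk
        · rw [List.mem_singleton.mp hk]; exact hj
      · simp [cs.wordProd_append]
      · simp [h, h3]
    · obtain ⟨a, ha, hea⟩ := exch cs ω j (by omega)
      refine ⟨ω.eraseIdx a, fun k hk => h1 k (List.mem_of_mem_eraseIdx hk), hea.symm, ?_⟩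
      rw [List.length_eraseIdx_of_lt ha]
      omega
  refine Subgroup.closure_induction_right (p := fun b _ => ∃ ω : List B, (∀ j ∈ ω, j ∈ J) ∧
    cs.wordProd ω = b ∧ ω.length = cs.length b) ?_ ?_ ?_ hb
  · exact ⟨[], by simp, by simp, by simp⟩
  · rintro x hx y ⟨j, hj, rfl⟩ h
    exact step x j hj h
  · rintro x hx y ⟨j, hj, rfl⟩ h
    rw [cs.inv_simple]
    exact step x j hj h

theorem exch2 (cs : CoxeterSystem M W) (ω₁ ω₂ : List B) (i : B)
    (h : cs.length (cs.wordProd ω₁ * cs.wordProd ω₂ * cs.simple i) <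
      cs.length (cs.wordProd ω₁ * cs.wordProd ω₂)) :
    (∃ a, a < ω₁.length ∧ cs.wordProd ω₁ * cs.wordProd ω₂ * cs.simple i =
      cs.wordProd (ω₁.eraseIdx a) * cs.wordProd ω₂) ∨
    (∃ a, a < ω₂.length ∧ cs.wordProd ω₂ * cs.simple i = cs.wordProd (ω₂.eraseIdx a)) := by
  rw [← cs.wordProd_append] at h
  obtain ⟨a, ha, hea⟩ := exch cs _ i h
  rcases Nat.lt_or_ge a ω₁.length with h1 | h1
  · left
    refine ⟨a, h1, ?_⟩
    rw [List.eraseIdx_append_of_lt_length h1, cs.wordProd_append, cs.wordProd_append] at hea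
    exact hea
  · right
    refine ⟨a - ω₁.length, by simp at ha; omega, ?_⟩
    rw [List.eraseIdx_append_of_length_le h1, cs.wordProd_append, cs.wordProd_append,
      mul_assoc, mul_right_inj] at hea
    exact hea

theorem lenE (cs : CoxeterSystem M W) {J : Set B} {w : W}
    (hw : ∀ j ∈ J, cs.length (w * cs.simple j) < cs.length w) {b : W} (hb : b ∈ par cs J) :
    cs.length (w * b) + cs.length b = cs.length w := by
  have main : ∀ ω : List B, (∀ j ∈ ω, j ∈ J) → cs.IsReduced ω →
      cs.length (w * (cs.wordProd ω)⁻¹) + ω.length = cs.length w := by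
    intro ω
    induction ω using List.reverseRecOn with
    | nil => simp
    | append_singleton ω j ih =>
      intro hJ hred
      have hred' : cs.IsReduced ω := by simpa using hred.take ω.length
      have ih := ih (fun k hk => hJ k (by simp [hk])) hred'
      obtain ⟨ωc, hc, hce⟩ := cs.exists_isReduced (w * (cs.wordProd ω)⁻¹)
      have hwe : w = cs.wordProd ωc * cs.wordProd ω := by rw [← hce]; group
      have hd := hw j (hJ j (by simp))
      have hcl := hc.eq
      rw [← hce] at hcl
      have hl : cs.length (cs.wordProd ω * cs.simple j) = ω.length + 1 := by
        have := hred.eq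
        rw [cs.wordProd_append] at this
        simpa using this
      rw [hwe] at hd
      rcases exch2 cs ωc ω j hd with ⟨a, ha, he⟩ | ⟨a, ha, he⟩
      · rw [← hwe] at he
        have e1 : w * (cs.wordProd (ω ++ [j]))⁻¹ = cs.wordProd (ωc.eraseIdx a) := by
          rw [cs.wordProd_append, cs.wordProd_singleton, mul_inv_rev, cs.inv_simple, ← mul_assoc,
            he, mul_inv_cancel_right]
        have l1 := cs.length_wordProd_le (ωc.eraseIdx a)
        rw [List.length_eraseIdx_of_lt ha] at l1
        have l2 := cs.length_mul_le (w * (cs.wordProd (ω ++ [j]))⁻¹) (cs.wordProd (ω ++ [j]))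
        rw [inv_mul_cancel_right, hred.eq] at l2
        rw [e1] at l2 ⊢
        simp only [List.length_append, List.length_singleton] at l2 ⊢
        omega
      · have l1 := cs.length_wordProd_le (ω.eraseIdx a)
        rw [List.length_eraseIdx_of_lt ha, ← he, hl] at l1
        omega
  obtain ⟨ω, h1, h2, h3⟩ := par_word cs ((par cs J).inv_mem hb)
  have := main ω h1 (by unfold CoxeterSystem.IsReduced; rw [h2, h3])
  rw [h2, inv_inv, h3, cs.length_inv] at this
  exact this

theorem simple_mem (cs : CoxeterSystem M W) {J : Set B} {j : B} (hj : j ∈ J) :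
    cs.simple j ∈ par cs J := Subgroup.subset_closure ⟨j, hj, rfl⟩

theorem longest_desc (cs : CoxeterSystem M W) {J : Set B} {w : W} (hw : IsLongest cs J w) :
    ∀ j ∈ J, cs.length (w * cs.simple j) < cs.length w := fun j hj =>
  lt_of_le_of_ne (hw.2 _ ((par cs J).mul_mem hw.1 (simple_mem cs hj))) (cs.length_mul_simple_ne w j)

theorem longest_inv (cs : CoxeterSystem M W) {J : Set B} {w : W} (hw : IsLongest cs J w) :
    w⁻¹ = w := by
  have := lenE cs (longest_desc cs hw) hw.1
  have h0 : cs.length (w * w) = 0 := by omega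
  rw [cs.length_eq_zero_iff] at h0
  exact inv_eq_of_mul_eq_one_left h0

theorem exists_longest (cs : CoxeterSystem M W) {J : Set B} (hJ : Finitary cs J) :
    ∃ w, IsLongest cs J w := by
  obtain ⟨w, hw, h⟩ := Set.exists_max_image (par cs J : Set W) cs.length hJ ⟨1, (par cs J).one_mem⟩
  exact ⟨w, hw, h⟩

/-- Conjugation form of the core condition. -/
def CC (cs : CoxeterSystem M W) (I : Set B) (x : W) (J : Set B) : Prop :=
  ∀ w, x⁻¹ * w * x ∈ par cs J ↔ w ∈ par cs I

theorem core_iff (cs : CoxeterSystem M W) (I : Set B) (x : W) (J : Set B) :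
    IsCore cs I x J ↔ CC cs I x J := by
  constructor
  · rintro ⟨h1, h2⟩ w
    constructor
    · intro hw
      have : w * x ∈ dcos cs I x J := ⟨1, one_mem _, _, hw, by group⟩
      rw [← h1] at this
      obtain ⟨a, ha, e⟩ := this
      rw [mul_left_inj] at e
      rwa [e]
    · intro hw
      have : w * x ∈ dcos cs I x J := ⟨w, hw, 1, one_mem _, by group⟩
      rw [h2] at this
      obtain ⟨a, ha, e⟩ := this
      rw [mul_assoc, e]
      simpa using ha
  · intro h
    constructor
    · ext y
      constructor
      · rintro ⟨a, ha, rfl⟩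
        exact ⟨a, ha, 1, one_mem _, by group⟩
      · rintro ⟨a, ha, b, hb, rfl⟩
        refine ⟨a * (x * b * x⁻¹), mul_mem ha ((h _).1 ?_), by group⟩
        have : x⁻¹ * (x * b * x⁻¹) * x = b := by group
        rwa [this]
    · ext y
      constructor
      · rintro ⟨a, ha, b, hb, rfl⟩
        exact ⟨x⁻¹ * a * x * b, mul_mem ((h _).2 ha) hb, by group⟩
      · rintro ⟨b, hb, rfl⟩
        exact ⟨1, one_mem _, b, hb, by group⟩

theorem CC.inv {cs : CoxeterSystem M W} {I J : Set B} {x : W} (h : CC cs I x J) :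
    CC cs J x⁻¹ I := by
  intro w
  rw [← h]
  have : x⁻¹ * (x⁻¹⁻¹ * w * x⁻¹) * x = w := by group
  rw [this]

theorem CC.trans_mem {cs : CoxeterSystem M W} {I J : Set B} {x a b : W} (h : CC cs I x J)
    (ha : a ∈ par cs I) (hb : b ∈ par cs J) : CC cs I (a * x * b) J := by
  intro w
  have e : (a * x * b)⁻¹ * w * (a * x * b) = b⁻¹ * (x⁻¹ * (a⁻¹ * w * a) * x) * b := by group
  rw [e, Subgroup.mul_mem_cancel_right _ hb, Subgroup.mul_mem_cancel_left _ (inv_mem hb), h,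
    Subgroup.mul_mem_cancel_right _ ha, Subgroup.mul_mem_cancel_left _ (inv_mem ha)]

theorem half (cs : CoxeterSystem M W) (I J K : Set B)
    (hJ : Finitary cs J) (hK : Finitary cs K)
    (hIJ : I.ncard = J.ncard)
    (wJ : W) (hwJ : IsLongest cs J wJ) (p q : W)
    (hpI : ∀ i ∈ I, cs.length (cs.simple i * p) < cs.length p)
    (hpJ : ∀ j ∈ J, cs.length (p * cs.simple j) < cs.length p)
    (hqK : ∀ k ∈ K, cs.length (q * cs.simple k) < cs.length q)
    (hred : cs.length (p * wJ * q) + cs.length wJ = cs.length p + cs.length q)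
    (hc : CC cs I (p * wJ * q) K) : CC cs I p J := by
  obtain ⟨wK, hwK⟩ := exists_longest cs hK
  have hJinv := longest_inv cs hwJ
  have hJsq : wJ * wJ = 1 := by nth_rw 1 [← hJinv]; simp
  set p' := p * wJ with hp'
  have hpp : p = p' * wJ := by rw [hp', mul_assoc, hJsq, mul_one]
  have lp' : cs.length p' + cs.length wJ = cs.length p := lenE cs hpJ hwJ.1
  have lb : ∀ b ∈ par cs J, cs.length (p' * b) = cs.length p' + cs.length b := by
    intro b hb
    have h1 := lenE cs hpJ (mul_mem hwJ.1 hb)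
    have h2 := lenE cs (longest_desc cs hwJ) hb
    rw [← mul_assoc, ← hp'] at h1
    omega
  set x := p' * q with hx
  have hxK : ∀ k ∈ K, cs.length (x * cs.simple k) < cs.length x := by
    intro k hk
    have h1 := hqK k hk
    have h2 := cs.length_mul_le p' (q * cs.simple k)
    rw [← mul_assoc, ← hx] at h2
    omega
  have lm := lenE cs hxK hwK.1
  have lq := lenE cs hqK hwK.1
  have hpI' : ∀ i ∈ I, cs.length (cs.simple i * p') = cs.length p' + 1 := by
    intro i hi
    rcases cs.length_simple_mul p' i with h | h
    · exact h
    exfalso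
    have hk : x⁻¹ * cs.simple i * x ∈ par cs K := (hc _).2 (simple_mem cs hi)
    have h1 := lenE cs hxK (mul_mem hk hwK.1)
    have e1 : x * (x⁻¹ * cs.simple i * x * wK) = cs.simple i * p' * (q * wK) := by
      rw [hx]; group
    have h2 := hwK.2 _ (mul_mem hk hwK.1)
    rw [e1] at h1
    have h3 := cs.length_mul_le (cs.simple i * p') (q * wK)
    omega
  have hsub : (fun w => p'⁻¹ * w * p') '' (cs.simple '' I) ⊆ cs.simple '' J := by
    rintro _ ⟨_, ⟨i, hi, rfl⟩, rfl⟩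
    have hmem : p'⁻¹ * cs.simple i * p' ∈ par cs J := by
      obtain ⟨ω₁, h1, e1, l1⟩ := par_word cs (inv_mem hwJ.1)
      obtain ⟨ω₂, h2, e2⟩ := cs.exists_isReduced p'⁻¹
      have hd := hpI i hi
      have e3 : cs.wordProd ω₁ * cs.wordProd ω₂ = p⁻¹ := by rw [e1, ← e2, hpp]; group
      rcases exch2 cs ω₁ ω₂ i (by
        rw [e3, cs.length_inv, ← cs.length_inv, mul_inv_rev, inv_inv, cs.inv_simple]
        exact hd) with ⟨a, ha, he⟩ | ⟨a, ha, he⟩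
      · rw [e1, ← e2] at he
        have hm : cs.wordProd (ω₁.eraseIdx a) ∈ par cs J :=
          word_mem cs fun j hj => h1 j (List.mem_of_mem_eraseIdx hj)
        have e4 : p'⁻¹ * cs.simple i * p' = wJ * cs.wordProd (ω₁.eraseIdx a) := by
          have : p'⁻¹ * cs.simple i = wJ * (wJ⁻¹ * p'⁻¹ * cs.simple i) := by group
          rw [this, he]; group
        rw [e4]
        exact mul_mem hwJ.1 hm
      · exfalso
        have l2 := cs.length_wordProd_le (ω₂.eraseIdx a)
        rw [List.length_eraseIdx_of_lt ha, ← he, ← e2, ← cs.length_inv, mul_inv_rev, inv_inv,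
          cs.inv_simple, hpI' i hi] at l2
        have l3 := h2.eq
        rw [← e2, cs.length_inv] at l3
        omega
    have l1 := lb _ hmem
    have e1 : p' * (p'⁻¹ * cs.simple i * p') = cs.simple i * p' := by group
    rw [e1, hpI' i hi] at l1
    obtain ⟨ω, h1, e2, l2⟩ := par_word cs hmem
    obtain ⟨j, rfl⟩ : ∃ j, ω = [j] := List.length_eq_one_iff.mp (by omega)
    exact ⟨j, h1 j (by simp), by simpa using e2⟩
  have hfin : (cs.simple '' J).Finite := hJ.subset Subgroup.subset_closure
  have heq : (fun w => p'⁻¹ * w * p') '' (cs.simple '' I) = cs.simple '' J := by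
    apply Set.eq_of_subset_of_ncard_le hsub _ hfin
    rw [Set.ncard_image_of_injective _ (simple_inj cs), Set.ncard_image_of_injective,
      Set.ncard_image_of_injective _ (simple_inj cs), hIJ]
    intro a b hab
    simpa using hab
  have hmap : (par cs I).map (MulAut.conj p'⁻¹).toMonoidHom = par cs J := by
    unfold par
    rw [MonoidHom.map_closure, ← heq]
    congr 1
    ext w
    simp
  have hcc : CC cs I p' J := by
    intro w
    rw [← hmap]
    constructor
    · rintro ⟨v, hv, e⟩
      have : v = w := by simpa using e
      rwa [← this]
    · intro hw
      exact ⟨w, hw, by simp⟩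
  have := hcc.trans_mem (one_mem _) hwJ.1
  rwa [one_mul, ← hpp] at this

theorem dcos_desc (cs : CoxeterSystem M W) {I J : Set B} {x y : W}
    (h : IsMaxOf cs (dcos cs I x J) y) :
    (∀ i ∈ I, cs.length (cs.simple i * y) < cs.length y) ∧
    (∀ j ∈ J, cs.length (y * cs.simple j) < cs.length y) := by
  obtain ⟨⟨a, ha, b, hb, rfl⟩, hmax⟩ := h
  constructor
  · intro i hi
    exact lt_of_le_of_ne (hmax _ ⟨cs.simple i * a, mul_mem (simple_mem cs hi) ha, b, hb, by group⟩)
      (cs.length_simple_mul_ne _ i)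
  · intro j hj
    exact lt_of_le_of_ne (hmax _ ⟨a, ha, b * cs.simple j, mul_mem hb (simple_mem cs hj), by group⟩)
      (cs.length_mul_simple_ne _ j)

theorem core_of_max (cs : CoxeterSystem M W) {I J : Set B} {x y : W}
    (h : IsMaxOf cs (dcos cs I x J) y) (hc : CC cs I y J) : IsCore cs I x J := by
  obtain ⟨⟨a, ha, b, hb, rfl⟩, -⟩ := h
  rw [core_iff]
  have := hc.trans_mem (inv_mem ha) (inv_mem hb)
  have e : a⁻¹ * (a * x * b) * b⁻¹ = x := by group
  rwa [e] at this

theorem statement_4 (cs : CoxeterSystem M W) (I J K : Set B)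
    (hI : Finitary cs I) (hJ : Finitary cs J) (hK : Finitary cs K)
    (hIJ : I.ncard = J.ncard) (hJK : J.ncard = K.ncard)
    (wJ : W) (hwJ : IsLongest cs J wJ)
    (xp xq pbar qbar : W)
    (hpmax : IsMaxOf cs (dcos cs I xp J) pbar)
    (hqmax : IsMaxOf cs (dcos cs J xq K) qbar)
    (hred : (cs.length (pbar * wJ * qbar) : ℤ) =
      (cs.length pbar : ℤ) - cs.length wJ + cs.length qbar)
    (hrcore : IsCore cs I (pbar * wJ * qbar) K) :
    IsCore cs I xp J ∧ IsCore cs J xq K := by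
  obtain ⟨p1, p2⟩ := dcos_desc cs hpmax
  obtain ⟨q1, q2⟩ := dcos_desc cs hqmax
  rw [core_iff] at hrcore
  refine ⟨core_of_max cs hpmax ?_, core_of_max cs hqmax ?_⟩
  · exact half cs I J K hJ hK hIJ wJ hwJ pbar qbar p1 p2 q2 (by omega) hrcore
  · have hw := longest_inv cs hwJ
    have e : qbar⁻¹ * wJ * pbar⁻¹ = (pbar * wJ * qbar)⁻¹ := by
      rw [mul_inv_rev, mul_inv_rev, hw, mul_assoc]
    have hl : ∀ (w : W) (i : B), cs.length (cs.simple i * w⁻¹) = cs.length (w * cs.simple i) := by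
      intro w i
      rw [← cs.length_inv, mul_inv_rev, inv_inv, cs.inv_simple]
    have hr : ∀ (w : W) (i : B), cs.length (w⁻¹ * cs.simple i) = cs.length (cs.simple i * w) := by
      intro w i
      rw [← cs.length_inv, mul_inv_rev, inv_inv, cs.inv_simple]
    have := half cs K J I hJ hI hJK.symm wJ hwJ qbar⁻¹ pbar⁻¹
      (fun i hi => by rw [hl, cs.length_inv]; exact q2 i hi)
      (fun i hi => by rw [hr, cs.length_inv]; exact q1 i hi)
      (fun i hi => by rw [hr, cs.length_inv]; exact p1 i hi)
      (by rw [e, cs.length_inv, cs.length_inv, cs.length_inv]; omega)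
      (by rw [e]; exact hrcore.inv)
    simpa using this.inv

end CoxeterAtoms
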